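/- For every real r > 0, the lattice sum over ℤ² minus the origin of (−1)^m/(m² + r·n²) equals −(π/√r)·log(2·g_r⁴); precisely, ∑_{n∈ℤ, n≠0} (∑_{m∈ℤ} (−1)^m/(m² + r·n²)) + ∑_{m∈ℤ, m≠0} (−1)^m/m² = −(π/√r)·log(2·g_r⁴), where each displayed sum is absolutely convergent. -/

import Mathlib

open Real Filter

/-- The one-variable Jacobi theta function `θ₂(q) = ∑_{n ∈ ℤ} q^((n + 1/2)²)`. -/
noncomputable def theta2 (q : ℝ) : ℝ := ∑' n : ℤ, q ^ (((n : ℝ) + 1 / 2) ^ 2)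

/-- The one-variable Jacobi theta function `θ₃(q) = ∑_{n ∈ ℤ} q^(n²)`. -/
noncomputable def theta3 (q : ℝ) : ℝ := ∑' n : ℤ, q ^ ((n : ℝ) ^ 2)

/-- The singular value `k_r = λ*(r) = θ₂(q)²/θ₃(q)²` with `q = exp(−π√r)`. -/
noncomputable def kSing (r : ℝ) : ℝ :=
  theta2 (Real.exp (-(π * Real.sqrt r))) ^ 2 / theta3 (Real.exp (-(π * Real.sqrt r))) ^ 2

/-- The Ramanujan g-invariant `g_r = ((1 − k_r²)/(2 k_r))^(1/12)`. -/
noncomputable def gRam (r : ℝ) : ℝ := ((1 - kSing r ^ 2) / (2 * kSing r)) ^ ((1 : ℝ) / 12)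

/-- The Gaussian binomial coefficient, defined by the `q`-Pascal rule. -/
noncomputable def qBinom (p : ℝ) : ℕ → ℕ → ℝ
  | _, 0 => 1
  | 0, _ + 1 => 0
  | n + 1, k + 1 => qBinom p n k + p ^ (k + 1) * qBinom p n (k + 1)

/-- The finite `q`-Pochhammer symbol `(p; p)_n = ∏_{1 ≤ i ≤ n} (1 - p ^ i)`. -/
noncomputable def qPoch (p : ℝ) (n : ℕ) : ℝ := ∏ i ∈ Finset.range n, (1 - p ^ (i + 1))

lemma qBinom_zero_right (p : ℝ) (n : ℕ) : qBinom p n 0 = 1 := by cases n <;> rfl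

lemma qBinom_succ_succ (p : ℝ) (n k : ℕ) :
    qBinom p (n + 1) (k + 1) = qBinom p n k + p ^ (k + 1) * qBinom p n (k + 1) := rfl

lemma qBinom_eq_zero_of_lt (p : ℝ) {n k : ℕ} (h : n < k) : qBinom p n k = 0 := by
  induction n generalizing k with
  | zero => obtain ⟨k, rfl⟩ := Nat.exists_eq_succ_of_ne_zero h.ne'; rfl
  | succ n ih =>
    obtain ⟨k, rfl⟩ := Nat.exists_eq_succ_of_ne_zero (Nat.ne_zero_of_lt h)
    rw [Nat.succ_eq_add_one, qBinom_succ_succ, ih (by omega), ih (by omega)]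
    simp

lemma qPoch_succ (p : ℝ) (n : ℕ) : qPoch p (n + 1) = qPoch p n * (1 - p ^ (n + 1)) :=
  Finset.prod_range_succ _ _

lemma qBinom_mul_qPoch (p : ℝ) (i j : ℕ) :
    qBinom p (i + j) i * (qPoch p i * qPoch p j) = qPoch p (i + j) := by
  induction hn : i + j generalizing i j with
  | zero =>
    obtain ⟨rfl, rfl⟩ : i = 0 ∧ j = 0 := by omega
    simp [qBinom_zero_right, qPoch]
  | succ n ih =>
    rcases i with _ | i
    · obtain rfl : j = n + 1 := by omega
      simp [qBinom_zero_right, qPoch]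
    · rw [qBinom_succ_succ, qPoch_succ p n, qPoch_succ p i]
      have h1 := ih i j (by omega)
      rcases j with _ | j
      · obtain rfl : n = i := by omega
        rw [qBinom_eq_zero_of_lt p (Nat.lt_succ_self n)]
        linear_combination (1 - p ^ (n + 1)) * h1
      · have h2 := ih (i + 1) j (by omega)
        rw [qPoch_succ p j] at h1 ⊢
        rw [qPoch_succ p i] at h2
        obtain rfl : n = i + j + 1 := by omega
        linear_combination (1 - p ^ (i + 1)) * h1 + p ^ (i + 1) * (1 - p ^ (j + 1)) * h2

/-- Cauchy's `q`-binomial theorem, with the nome normalised as in the theta functions. -/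
lemma prod_one_add_eq_sum_qBinom (q : ℝ) (M : ℕ) (z : ℝ) :
    ∏ k ∈ Finset.range M, (1 + z * q ^ (2 * k + 1)) =
      ∑ i ∈ Finset.range (M + 1), qBinom (q ^ 2) M i * (q ^ i ^ 2 * z ^ i) := by
  induction M generalizing z with
  | zero => simp [qBinom_zero_right]
  | succ M ih =>
    rw [Finset.prod_range_succ']
    have h : ∀ k, 1 + z * q ^ (2 * (k + 1) + 1) = 1 + (z * q ^ 2) * q ^ (2 * k + 1) := by
      intro k; ring
    simp_rw [h]
    rw [ih, Finset.sum_range_succ' _ (M + 1)]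
    simp_rw [qBinom_succ_succ, add_mul, Finset.sum_add_distrib]
    have e1 : ∑ i ∈ Finset.range (M + 1), qBinom (q ^ 2) M i * (q ^ (i + 1) ^ 2 * z ^ (i + 1)) =
        z * q * ∑ i ∈ Finset.range (M + 1), qBinom (q ^ 2) M i * (q ^ i ^ 2 * (z * q ^ 2) ^ i) := by
      rw [Finset.mul_sum]
      exact Finset.sum_congr rfl fun i _ => by ring
    have e2 : ∑ i ∈ Finset.range (M + 1), qBinom (q ^ 2) M i * (q ^ i ^ 2 * (z * q ^ 2) ^ i) =
        ∑ i ∈ Finset.range (M + 1), (q ^ 2) ^ (i + 1) * qBinom (q ^ 2) M (i + 1) *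
          (q ^ (i + 1) ^ 2 * z ^ (i + 1)) + 1 := by
      rw [← add_zero (∑ i ∈ Finset.range (M + 1), qBinom (q ^ 2) M i * _),
        ← zero_mul (q ^ (M + 1) ^ 2 * (z * q ^ 2) ^ (M + 1)),
        ← qBinom_eq_zero_of_lt (q ^ 2) (Nat.lt_succ_self M), ← Finset.sum_range_succ,
        Finset.sum_range_succ']
      congr 1
      · exact Finset.sum_congr rfl fun i _ => by ring
      · simp [qBinom_zero_right]
    rw [e1, qBinom_zero_right]
    linear_combination e2

lemma prod_mul_prod_eq_sum_qBinom {q z : ℝ} (hq : q ≠ 0) (hz : z ≠ 0) (M N : ℕ) :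
    (∏ k ∈ Finset.range M, (1 + z * q ^ (2 * k + 1))) *
      ∏ k ∈ Finset.range N, (1 + z⁻¹ * q ^ (2 * k + 1)) =
      ∑ i ∈ Finset.range (M + N + 1),
        qBinom (q ^ 2) (M + N) i * (q ^ (((i : ℤ) - N) ^ 2) * z ^ ((i : ℤ) - N)) := by
  induction N with
  | zero =>
    simp only [Finset.range_zero, Finset.prod_empty, mul_one, Nat.cast_zero, sub_zero, add_zero]
    rw [prod_one_add_eq_sum_qBinom]
    refine Finset.sum_congr rfl fun i _ => ?_
    rw [← Nat.cast_pow, zpow_natCast, zpow_natCast]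
  | succ N ih =>
    rw [Finset.prod_range_succ, ← mul_assoc, ih, ← add_assoc, Finset.sum_range_succ' _ (M + N + 1)]
    simp_rw [qBinom_succ_succ, add_mul, Finset.sum_add_distrib]
    have e1 : ∀ i : ℕ, (((i + 1 : ℕ) : ℤ) - (N + 1 : ℕ)) = (i : ℤ) - N := by
      intro i; push_cast; ring
    have key : ∀ i : ℕ, (q ^ 2) ^ i * (q ^ (((i : ℤ) - (N + 1 : ℕ)) ^ 2) *
        z ^ ((i : ℤ) - (N + 1 : ℕ))) =
        (q ^ (((i : ℤ) - N) ^ 2) * z ^ ((i : ℤ) - N)) * (z⁻¹ * q ^ (2 * N + 1)) := by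
      intro i
      have h1 : (i : ℤ) - (N + 1 : ℕ) = ((i : ℤ) - N) + (-1) := by push_cast; ring
      have h2 : (q ^ 2) ^ i = q ^ (2 * i : ℤ) := by rw [← pow_mul]; exact_mod_cast rfl
      have h3 : q ^ (2 * N + 1) = q ^ (2 * N + 1 : ℤ) := by exact_mod_cast rfl
      rw [h1, zpow_add₀ hz, zpow_neg_one, h2, h3, ← mul_assoc, ← zpow_add₀ hq]
      have h4 : (2 * i : ℤ) + ((i : ℤ) - N + -1) ^ 2 = ((i : ℤ) - N) ^ 2 + (2 * N + 1) := by ring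
      rw [h4, zpow_add₀ hq]
      ring
    simp_rw [e1]
    have e2 : ∑ i ∈ Finset.range (M + N + 1), qBinom (q ^ 2) (M + N) i *
        (q ^ (((i : ℤ) - N) ^ 2) * z ^ ((i : ℤ) - N)) * (z⁻¹ * q ^ (2 * N + 1)) =
        ∑ i ∈ Finset.range (M + N + 1), (q ^ 2) ^ (i + 1) * qBinom (q ^ 2) (M + N) (i + 1) *
          (q ^ (((i : ℤ) - N) ^ 2) * z ^ ((i : ℤ) - N)) +
        qBinom (q ^ 2) (M + N + 1) 0 * (q ^ ((((0 : ℕ) : ℤ) - (N + 1 : ℕ)) ^ 2) *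
          z ^ (((0 : ℕ) : ℤ) - (N + 1 : ℕ))) := by
      have h0 : qBinom (q ^ 2) (M + N) (M + N + 1) = 0 :=
        qBinom_eq_zero_of_lt (q ^ 2) (Nat.lt_succ_self _)
      have h5 := Finset.sum_range_succ (fun i : ℕ => qBinom (q ^ 2) (M + N) i *
        (q ^ (((i : ℤ) - N) ^ 2) * z ^ ((i : ℤ) - N)) * (z⁻¹ * q ^ (2 * N + 1))) (M + N + 1)
      rw [h0, zero_mul, zero_mul, add_zero] at h5
      rw [← h5, Finset.sum_range_succ']
      congr 1
      · refine Finset.sum_congr rfl fun i _ => ?_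
        have := key (i + 1)
        rw [e1] at this
        linear_combination -qBinom (q ^ 2) (M + N) (i + 1) * this
      · have := key 0
        rw [qBinom_zero_right, qBinom_zero_right]
        linear_combination -this
    rw [mul_add, mul_one, Finset.sum_mul, e2]
    ring

lemma summable_theta_nat {q z : ℝ} (hq0 : 0 < q) (hq1 : q < 1) (hz : z ≠ 0) :
    Summable fun n : ℕ => q ^ n ^ 2 * z ^ n := by
  refine summable_of_ratio_test_tendsto_lt_one zero_lt_one
    (Eventually.of_forall fun n => by positivity) ?_
  have h : ∀ n : ℕ, ‖q ^ (n + 1) ^ 2 * z ^ (n + 1)‖ / ‖q ^ n ^ 2 * z ^ n‖ =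
      q * |z| * (q ^ 2) ^ n := by
    intro n
    have hz' : |z| ≠ 0 := by positivity
    rw [← norm_div, Real.norm_eq_abs, div_eq_iff_mul_eq (a := q ^ (n + 1) ^ 2 * z ^ (n + 1))
      (c := q * z * (q ^ 2) ^ n) (by positivity) |>.mpr (by ring)]
    rw [abs_mul, abs_mul, abs_of_pos hq0, abs_of_pos (by positivity : 0 < (q ^ 2) ^ n)]
  simp_rw [h]
  simpa using (tendsto_pow_atTop_nhds_zero_of_lt_one (by positivity : 0 ≤ q ^ 2)
    (by nlinarith : q ^ 2 < 1)).const_mul (q * |z|)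

lemma summable_theta {q z : ℝ} (hq0 : 0 < q) (hq1 : q < 1) (hz : z ≠ 0) :
    Summable fun j : ℤ => q ^ (j ^ 2) * z ^ j := by
  refine Summable.of_nat_of_neg ?_ ?_
  · exact_mod_cast summable_theta_nat hq0 hq1 hz
  · have := summable_theta_nat hq0 hq1 (inv_ne_zero hz)
    refine this.congr fun n => ?_
    rw [neg_sq, zpow_neg, inv_pow]
    exact_mod_cast rfl

lemma summable_pow_mul_add {q : ℝ} (hq0 : 0 < q) (hq1 : q < 1) {a : ℕ} (ha : a ≠ 0) (b : ℕ) :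
    Summable fun n : ℕ => q ^ (a * n + b) := by
  simp_rw [pow_add, pow_mul]
  exact (summable_geometric_of_lt_one (by positivity) (pow_lt_one₀ hq0.le hq1 ha)).mul_right _

lemma multipliable_one_add_mul_pow {q : ℝ} (hq0 : 0 < q) (hq1 : q < 1) {a : ℕ} (ha : a ≠ 0)
    (b : ℕ) (z : ℝ) : Multipliable fun n : ℕ => 1 + z * q ^ (a * n + b) :=
  Real.multipliable_one_add_of_summable ((summable_pow_mul_add hq0 hq1 ha b).mul_left z)

lemma multipliable_one_sub_pow {q : ℝ} (hq0 : 0 < q) (hq1 : q < 1) {a : ℕ} (ha : a ≠ 0)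
    (b : ℕ) : Multipliable fun n : ℕ => 1 - q ^ (a * n + b) := by
  simpa [sub_eq_add_neg] using multipliable_one_add_mul_pow hq0 hq1 ha b (-1)

lemma tendsto_qPoch {q : ℝ} (hq0 : 0 < q) (hq1 : q < 1) :
    Tendsto (qPoch (q ^ 2)) atTop (nhds (∏' n : ℕ, (1 - q ^ (2 * n + 2)))) := by
  refine (multipliable_one_sub_pow hq0 hq1 two_ne_zero 2).hasProd.tendsto_prod_nat.congr fun n => ?_
  exact Finset.prod_congr rfl fun i _ => by ring

lemma tprod_one_sub_pow_pos {q : ℝ} (hq0 : 0 < q) (hq1 : q < 1) {a : ℕ} (ha : a ≠ 0)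
    (b : ℕ) (hb : b ≠ 0) : 0 < ∏' n : ℕ, (1 - q ^ (a * n + b)) := by
  have h : ∀ n : ℕ, 0 < 1 - q ^ (a * n + b) := fun n =>
    sub_pos.2 (pow_lt_one₀ hq0.le hq1 (by omega))
  refine lt_of_le_of_ne (tprod_nonneg fun n => (h n).le) (Ne.symm ?_)
  have := tprod_one_add_ne_zero_of_summable (f := fun n : ℕ => -q ^ (a * n + b))
    (fun n => by rw [← sub_eq_add_neg]; exact (h n).ne')
    (by simpa using (summable_pow_mul_add hq0 hq1 ha b).abs)
  simpa [← sub_eq_add_neg] using this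

lemma tprod_le_qPoch {q : ℝ} (hq0 : 0 < q) (hq1 : q < 1) (n : ℕ) :
    ∏' n : ℕ, (1 - q ^ (2 * n + 2)) ≤ qPoch (q ^ 2) n := by
  have hq2 : q ^ 2 < 1 := pow_lt_one₀ hq0.le hq1 two_ne_zero
  refine (antitone_nat_of_succ_le fun n => ?_).le_of_tendsto (tendsto_qPoch hq0 hq1) n
  rw [qPoch_succ]
  refine mul_le_of_le_one_right (Finset.prod_nonneg fun i _ => ?_) ?_
  · exact sub_nonneg.2 (pow_le_one₀ (by positivity) hq2.le)
  · linarith [pow_pos (pow_pos hq0 2) (n + 1)]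

/-- The coefficient of `z ^ j` in the finite form of the triple product. -/
noncomputable def tripleCoeff (p : ℝ) (N : ℕ) (j : ℤ) : ℝ :=
  if -(N : ℤ) ≤ j then qBinom p (N + N) (j + N).toNat else 0

lemma prod_mul_prod_eq_tsum {q z : ℝ} (hq : q ≠ 0) (hz : z ≠ 0) (N : ℕ) :
    (∏ k ∈ Finset.range N, (1 + z * q ^ (2 * k + 1))) *
      ∏ k ∈ Finset.range N, (1 + z⁻¹ * q ^ (2 * k + 1)) =
      ∑' j : ℤ, tripleCoeff (q ^ 2) N j * (q ^ (j ^ 2) * z ^ j) := by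
  rw [prod_mul_prod_eq_sum_qBinom hq hz, tsum_eq_sum (s := Finset.Icc (-(N : ℤ)) N)]
  · refine Finset.sum_nbij' (fun i => (i : ℤ) - N) (fun j => (j + N).toNat) ?_ ?_ ?_ ?_ ?_
    · intro i hi; simp at hi ⊢; omega
    · intro i hi; simp at hi ⊢; omega
    · intro i hi; simp
    · intro i hi; simp at hi ⊢; omega
    · intro i hi; simp [tripleCoeff]
  · intro j hj
    rw [tripleCoeff]
    split_ifs with h
    · rw [qBinom_eq_zero_of_lt, zero_mul]
      simp at hj; omega
    · simp

lemma tripleCoeff_mul_qPoch (p : ℝ) {N : ℕ} {j : ℤ} (h : |j| ≤ N) :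
    tripleCoeff p N j * (qPoch p (j + N).toNat * qPoch p (N - j).toNat) = qPoch p (N + N) := by
  rw [abs_le] at h
  rw [tripleCoeff, if_pos h.1]
  have : N + N = (j + N).toNat + (N - j).toNat := by omega
  rw [this, qBinom_mul_qPoch]

lemma tripleCoeff_eq_zero (p : ℝ) {N : ℕ} {j : ℤ} (h : ¬ |j| ≤ N) : tripleCoeff p N j = 0 := by
  rw [tripleCoeff]
  split_ifs with h'
  · rw [abs_le] at h
    exact qBinom_eq_zero_of_lt _ (by omega)
  · rfl

lemma tendsto_tripleCoeff {q : ℝ} (hq0 : 0 < q) (hq1 : q < 1) (j : ℤ) :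
    Tendsto (fun N => tripleCoeff (q ^ 2) N j) atTop
      (nhds (∏' n : ℕ, (1 - q ^ (2 * n + 2)))⁻¹) := by
  have hA := tprod_one_sub_pow_pos hq0 hq1 two_ne_zero 2 two_ne_zero
  set A := ∏' n : ℕ, (1 - q ^ (2 * n + 2)) with hAdef
  have ht := tendsto_qPoch hq0 hq1
  rw [← hAdef] at ht
  have h1 : Tendsto (fun N : ℕ => (j + N).toNat) atTop atTop :=
    tendsto_atTop.2 fun b => by
      filter_upwards [eventually_ge_atTop (b + j.natAbs)] with N hN
      omega
  have h2 : Tendsto (fun N : ℕ => ((N : ℤ) - j).toNat) atTop atTop :=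
    tendsto_atTop.2 fun b => by
      filter_upwards [eventually_ge_atTop (b + j.natAbs)] with N hN
      omega
  have h3 : Tendsto (fun N : ℕ => N + N) atTop atTop :=
    tendsto_atTop.2 fun b => by
      filter_upwards [eventually_ge_atTop b] with N hN
      omega
  have h4 := (ht.comp h3).div ((ht.comp h1).mul (ht.comp h2)) (by positivity)
  rw [show A⁻¹ = A / (A * A) by field_simp]
  refine h4.congr' ?_
  filter_upwards [eventually_ge_atTop j.natAbs] with N hN
  have hp := fun n => (hA.trans_le (tprod_le_qPoch hq0 hq1 n)).ne'
  have := tripleCoeff_mul_qPoch (q ^ 2) (N := N) (j := j) (by rw [Int.abs_eq_natAbs]; omega)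
  simp only [Pi.div_apply, Function.comp]
  rw [← this, mul_div_assoc, div_self (mul_ne_zero (hp _) (hp _)), mul_one]

lemma abs_tripleCoeff_le {q : ℝ} (hq0 : 0 < q) (hq1 : q < 1) (N : ℕ) (j : ℤ) :
    |tripleCoeff (q ^ 2) N j| ≤ ((∏' n : ℕ, (1 - q ^ (2 * n + 2))) ^ 2)⁻¹ := by
  have hA := tprod_one_sub_pow_pos hq0 hq1 two_ne_zero 2 two_ne_zero
  have hle := tprod_le_qPoch hq0 hq1
  set A := ∏' n : ℕ, (1 - q ^ (2 * n + 2))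
  by_cases h : |j| ≤ N
  · have e := tripleCoeff_mul_qPoch (q ^ 2) h
    have h1 := hle (j + N).toNat
    have h2 := hle (N - j).toNat
    have hp : 0 < qPoch (q ^ 2) (j + N).toNat * qPoch (q ^ 2) (N - j).toNat :=
      mul_pos (hA.trans_le h1) (hA.trans_le h2)
    have h3 : qPoch (q ^ 2) (N + N) ≤ 1 := by
      refine Finset.prod_le_one (fun i _ => ?_) fun i _ => ?_
      · exact sub_nonneg.2 (pow_le_one₀ (by positivity) (pow_le_one₀ hq0.le hq1.le))
      · linarith [pow_pos (pow_pos hq0 2) (i + 1)]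
    rw [eq_div_of_mul_eq hp.ne' e, abs_of_pos (div_pos (hA.trans_le (hle _)) hp), ← one_div]
    refine div_le_div₀ zero_le_one h3 (by positivity) ?_
    rw [sq]
    exact mul_le_mul h1 h2 hA.le (hA.le.trans h1)
  · rw [tripleCoeff_eq_zero _ h, abs_zero]
    positivity

/-- **Jacobi's triple product identity.** -/
theorem jacobi_triple_product {q z : ℝ} (hq0 : 0 < q) (hq1 : q < 1) (hz : z ≠ 0) :
    ∑' j : ℤ, q ^ (j ^ 2) * z ^ j =
      (∏' n : ℕ, (1 - q ^ (2 * n + 2))) * (∏' n : ℕ, (1 + z * q ^ (2 * n + 1))) *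
        ∏' n : ℕ, (1 + z⁻¹ * q ^ (2 * n + 1)) := by
  have hA := tprod_one_sub_pow_pos hq0 hq1 two_ne_zero 2 two_ne_zero
  have hlim := tendsto_tsum_of_dominated_convergence (𝓕 := atTop)
    (f := fun N (j : ℤ) => tripleCoeff (q ^ 2) N j * (q ^ (j ^ 2) * z ^ j))
    (g := fun j : ℤ => (∏' n : ℕ, (1 - q ^ (2 * n + 2)))⁻¹ * (q ^ (j ^ 2) * z ^ j))
    (bound := fun j : ℤ => ((∏' n : ℕ, (1 - q ^ (2 * n + 2))) ^ 2)⁻¹ * |q ^ (j ^ 2) * z ^ j|)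
    ((summable_theta hq0 hq1 hz).abs.mul_left _)
    (fun j => (tendsto_tripleCoeff hq0 hq1 j).mul_const _)
    (Eventually.of_forall fun N j => by
      rw [norm_mul]
      exact mul_le_mul_of_nonneg_right (abs_tripleCoeff_le hq0 hq1 N j) (norm_nonneg _))
  simp_rw [← prod_mul_prod_eq_tsum hq0.ne' hz] at hlim
  have hlim' := (multipliable_one_add_mul_pow hq0 hq1 two_ne_zero 1 z).hasProd.tendsto_prod_nat.mul
    (multipliable_one_add_mul_pow hq0 hq1 two_ne_zero 1 z⁻¹).hasProd.tendsto_prod_nat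
  have := tendsto_nhds_unique hlim hlim'
  rw [tsum_mul_left, inv_mul_eq_iff_eq_mul₀ hA.ne'] at this
  rw [this, mul_assoc]

/-- Split `ℤ × ℤ` according to the parity of the sum of the coordinates. -/
lemma tsum_prod_parity {F : ℤ × ℤ → ℝ} (hF : Summable F) :
    ∑' x, F x = ∑' x : ℤ × ℤ, F (x.1 + x.2, x.1 - x.2) +
      ∑' x : ℤ × ℤ, F (x.1 + x.2 + 1, x.1 - x.2) := by
  let g : (ℤ × ℤ) ⊕ (ℤ × ℤ) → ℤ × ℤ := Sum.elim (fun x => (x.1 + x.2, x.1 - x.2))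
    (fun x => (x.1 + x.2 + 1, x.1 - x.2))
  have hg : Function.Bijective g := by
    constructor
    · rintro (⟨a, b⟩ | ⟨a, b⟩) (⟨c, d⟩ | ⟨c, d⟩) h <;>
        simp only [g, Sum.elim_inl, Sum.elim_inr, Prod.mk.injEq] at h <;> simp <;> omega
    · rintro ⟨m, n⟩
      rcases Int.even_or_odd' (m + n) with ⟨k, hk | hk⟩
      · exact ⟨Sum.inl (k, k - n), by simp only [g, Sum.elim_inl, Prod.mk.injEq]; omega⟩
      · exact ⟨Sum.inr (k, k - n), by simp only [g, Sum.elim_inr, Prod.mk.injEq]; omega⟩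
  have hs : Summable (F ∘ g) := hF.comp_injective hg.1
  rw [← (Equiv.ofBijective g hg).tsum_eq F]
  exact Summable.tsum_sum (f := F ∘ g) (hs.comp_injective Sum.inl_injective)
    (hs.comp_injective Sum.inr_injective)

lemma tsum_sq_eq_parity {f : ℤ → ℝ} (hf : Summable f) :
    (∑' j, f j) ^ 2 = ∑' x : ℤ × ℤ, f (x.1 + x.2) * f (x.1 - x.2) +
      ∑' x : ℤ × ℤ, f (x.1 + x.2 + 1) * f (x.1 - x.2) := by
  rw [sq, tsum_mul_tsum_of_summable_norm hf.norm hf.norm]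
  exact tsum_prod_parity (summable_mul_of_summable_norm hf.norm hf.norm)

lemma tsum_mul_tsum_int {f g : ℤ → ℝ} (hf : Summable f) (hg : Summable g) :
    ∑' x : ℤ × ℤ, f x.1 * g x.2 = (∑' j, f j) * ∑' j, g j :=
  (tsum_mul_tsum_of_summable_norm hf.norm hg.norm).symm

lemma summable_zpow_sq {q : ℝ} (hq0 : 0 < q) (hq1 : q < 1) :
    Summable fun j : ℤ => q ^ (j ^ 2) := by
  simpa using summable_theta hq0 hq1 one_ne_zero

lemma summable_zpow_sq_add {q : ℝ} (hq0 : 0 < q) (hq1 : q < 1) :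
    Summable fun j : ℤ => q ^ (j ^ 2 + j) := by
  simpa [zpow_add₀ hq0.ne'] using summable_theta hq0 hq1 hq0.ne'

lemma theta3_sq_duplication {q : ℝ} (hq0 : 0 < q) (hq1 : q < 1) :
    (∑' j : ℤ, q ^ (j ^ 2)) ^ 2 = (∑' j : ℤ, (q ^ 2) ^ (j ^ 2)) ^ 2 +
      q * (∑' j : ℤ, (q ^ 2) ^ (j ^ 2 + j)) ^ 2 := by
  have hp0 : 0 < q ^ 2 := by positivity
  have hp1 : q ^ 2 < 1 := pow_lt_one₀ hq0.le hq1 two_ne_zero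
  have h2 : ∀ n : ℤ, (q ^ 2) ^ n = q ^ (2 * n) := fun n => by
    rw [zpow_mul]; norm_cast
  rw [tsum_sq_eq_parity (summable_zpow_sq hq0 hq1), sq (∑' j : ℤ, (q ^ 2) ^ (j ^ 2)),
    sq (∑' j : ℤ, (q ^ 2) ^ (j ^ 2 + j)),
    ← tsum_mul_tsum_int (summable_zpow_sq hp0 hp1) (summable_zpow_sq hp0 hp1),
    ← tsum_mul_tsum_int (summable_zpow_sq_add hp0 hp1) (summable_zpow_sq_add hp0 hp1),
    ← tsum_mul_left]
  congr 1
  · refine tsum_congr fun x => ?_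
    rw [h2, h2, ← zpow_add₀ hq0.ne', ← zpow_add₀ hq0.ne']
    ring_nf
  · refine tsum_congr fun x => ?_
    rw [h2, h2, ← zpow_add₀ hq0.ne', ← zpow_add₀ hq0.ne', ← zpow_one_add₀ hq0.ne']
    ring_nf

lemma theta4_sq_duplication {q : ℝ} (hq0 : 0 < q) (hq1 : q < 1) :
    (∑' j : ℤ, q ^ (j ^ 2) * (-1) ^ j) ^ 2 = (∑' j : ℤ, (q ^ 2) ^ (j ^ 2)) ^ 2 -
      q * (∑' j : ℤ, (q ^ 2) ^ (j ^ 2 + j)) ^ 2 := by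
  have hp0 : 0 < q ^ 2 := by positivity
  have hp1 : q ^ 2 < 1 := pow_lt_one₀ hq0.le hq1 two_ne_zero
  have h2 : ∀ n : ℤ, (q ^ 2) ^ n = q ^ (2 * n) := fun n => by
    rw [zpow_mul]; norm_cast
  have hs : ∀ a b : ℤ, (-1 : ℝ) ^ (a + b) * (-1) ^ (a - b) = 1 := fun a b => by
    rw [← zpow_add₀ (by norm_num), show a + b + (a - b) = 2 * a by ring, zpow_mul]
    norm_num
  rw [tsum_sq_eq_parity (summable_theta hq0 hq1 (by norm_num)),
    sq (∑' j : ℤ, (q ^ 2) ^ (j ^ 2)), sq (∑' j : ℤ, (q ^ 2) ^ (j ^ 2 + j)),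
    ← tsum_mul_tsum_int (summable_zpow_sq hp0 hp1) (summable_zpow_sq hp0 hp1),
    ← tsum_mul_tsum_int (summable_zpow_sq_add hp0 hp1) (summable_zpow_sq_add hp0 hp1),
    ← tsum_mul_left, sub_eq_add_neg, ← tsum_neg]
  congr 1
  · refine tsum_congr fun x => ?_
    rw [mul_mul_mul_comm, hs, mul_one, h2, h2, ← zpow_add₀ hq0.ne', ← zpow_add₀ hq0.ne']
    ring_nf
  · refine tsum_congr fun x => ?_
    rw [mul_mul_mul_comm, zpow_add_one₀ (by norm_num : (-1 : ℝ) ≠ 0), mul_right_comm _ (-1 : ℝ),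
      hs, one_mul, mul_neg_one, h2, h2, ← zpow_add₀ hq0.ne', ← zpow_add₀ hq0.ne',
      ← zpow_one_add₀ hq0.ne']
    ring_nf

lemma theta2_sq_duplication {q : ℝ} (hq0 : 0 < q) (hq1 : q < 1) :
    (∑' j : ℤ, q ^ (j ^ 2 + j)) ^ 2 =
      2 * ((∑' j : ℤ, (q ^ 2) ^ (j ^ 2)) * ∑' j : ℤ, (q ^ 2) ^ (j ^ 2 + j)) := by
  have hp0 : 0 < q ^ 2 := by positivity
  have hp1 : q ^ 2 < 1 := pow_lt_one₀ hq0.le hq1 two_ne_zero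
  have h2 : ∀ n : ℤ, (q ^ 2) ^ n = q ^ (2 * n) := fun n => by
    rw [zpow_mul]; norm_cast
  rw [tsum_sq_eq_parity (summable_zpow_sq_add hq0 hq1), two_mul]
  congr 1
  · rw [mul_comm, ← tsum_mul_tsum_int (summable_zpow_sq_add hp0 hp1) (summable_zpow_sq hp0 hp1)]
    refine tsum_congr fun x => ?_
    rw [h2, h2, ← zpow_add₀ hq0.ne', ← zpow_add₀ hq0.ne']
    ring_nf
  · have hshift : ∑' j : ℤ, (q ^ 2) ^ ((j + 1) ^ 2) = ∑' j : ℤ, (q ^ 2) ^ (j ^ 2) :=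
      (Equiv.addRight (1 : ℤ)).tsum_eq fun j : ℤ => (q ^ 2) ^ (j ^ 2)
    have hs : Summable fun j : ℤ => (q ^ 2) ^ ((j + 1) ^ 2) :=
      (summable_zpow_sq hp0 hp1).comp_injective (add_left_injective (1 : ℤ))
    rw [← hshift, ← tsum_mul_tsum_int hs (summable_zpow_sq_add hp0 hp1)]
    refine tsum_congr fun x => ?_
    rw [h2, h2, ← zpow_add₀ hq0.ne', ← zpow_add₀ hq0.ne']
    ring_nf

/-- Jacobi's identity `θ₃⁴ = θ₄⁴ + θ₂⁴`, with `θ₂ = q ^ (1 / 4) * ∑ q ^ (j ^ 2 + j)`. -/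
lemma jacobi_theta_quartic {q : ℝ} (hq0 : 0 < q) (hq1 : q < 1) :
    (∑' j : ℤ, q ^ (j ^ 2)) ^ 4 =
      (∑' j : ℤ, q ^ (j ^ 2) * (-1) ^ j) ^ 4 + q * (∑' j : ℤ, q ^ (j ^ 2 + j)) ^ 4 := by
  have h3 := theta3_sq_duplication hq0 hq1
  have h4 := theta4_sq_duplication hq0 hq1
  have h2 := theta2_sq_duplication hq0 hq1
  generalize ∑' j : ℤ, q ^ (j ^ 2) = t3 at *
  generalize ∑' j : ℤ, q ^ (j ^ 2) * (-1) ^ j = t4 at *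
  generalize ∑' j : ℤ, q ^ (j ^ 2 + j) = t2 at *
  rw [← sub_eq_zero, show t3 ^ 4 - (t4 ^ 4 + q * t2 ^ 4) =
    (t3 ^ 2) ^ 2 - ((t4 ^ 2) ^ 2 + q * (t2 ^ 2) ^ 2) by ring, h3, h4, h2]
  ring

lemma tprod_pow_two_mul {q : ℝ} (hq0 : 0 < q) (hq1 : q < 1) :
    ∏' n : ℕ, (1 + q ^ (2 * n)) = 2 * ∏' n : ℕ, (1 + q ^ (2 * n + 2)) := by
  have h : Multipliable fun n : ℕ => 1 + q ^ (2 * (n + 1)) := by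
    simpa only [one_mul, mul_add, mul_one] using
      multipliable_one_add_mul_pow hq0 hq1 two_ne_zero 2 1
  rw [tprod_eq_zero_mul' (f := fun n : ℕ => 1 + q ^ (2 * n)) h, mul_zero, pow_zero,
    one_add_one_eq_two]
  rfl

/-- Euler's identity `∏ (1 - q ^ (2n+1)) * ∏ (1 + q ^ n) = 1`, split by parity. -/
lemma tprod_euler {q : ℝ} (hq0 : 0 < q) (hq1 : q < 1) :
    (∏' n : ℕ, (1 - q ^ (2 * n + 1))) * ((∏' n : ℕ, (1 + q ^ (2 * n + 1))) *
      ∏' n : ℕ, (1 + q ^ (2 * n + 2))) = 1 := by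
  have hA := tprod_one_sub_pow_pos hq0 hq1 two_ne_zero 2 two_ne_zero
  have hm : ∀ {a : ℕ}, a ≠ 0 → ∀ b, Multipliable fun n : ℕ => 1 + q ^ (a * n + b) := fun ha b => by
    simpa using multipliable_one_add_mul_pow hq0 hq1 ha b 1
  have hm' := @multipliable_one_sub_pow q hq0 hq1
  have e1 := tprod_even_mul_odd (f := fun n : ℕ => 1 - q ^ (n + 1)) (hm' two_ne_zero 1)
    (hm' two_ne_zero 2)
  have e2 := tprod_even_mul_odd (f := fun n : ℕ => 1 + q ^ (n + 1)) (hm two_ne_zero 1)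
    (hm two_ne_zero 2)
  have e3 : (∏' n : ℕ, (1 - q ^ (n + 1))) * ∏' n : ℕ, (1 + q ^ (n + 1)) =
      ∏' n : ℕ, (1 - q ^ (2 * n + 2)) := by
    rw [← Multipliable.tprod_mul (by simpa using hm' one_ne_zero 1)
      (by simpa using hm one_ne_zero 1)]
    exact tprod_congr fun n => by ring
  rw [← e1, ← e2] at e3
  refine mul_left_cancel₀ hA.ne' ?_
  linear_combination e3

lemma theta3_eq_tsum_zpow (q : ℝ) : theta3 q = ∑' j : ℤ, q ^ (j ^ 2) := by
  refine tsum_congr fun j => ?_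
  rw [← Real.rpow_intCast]
  push_cast
  rfl

lemma theta3_eq {q : ℝ} (hq0 : 0 < q) (hq1 : q < 1) :
    theta3 q = (∏' n : ℕ, (1 - q ^ (2 * n + 2))) * (∏' n : ℕ, (1 + q ^ (2 * n + 1))) ^ 2 := by
  have h := jacobi_triple_product hq0 hq1 one_ne_zero
  simp only [one_zpow, mul_one, one_mul, inv_one] at h
  rw [sq, ← mul_assoc, ← h, theta3_eq_tsum_zpow]

lemma theta4_eq {q : ℝ} (hq0 : 0 < q) (hq1 : q < 1) :
    ∑' j : ℤ, q ^ (j ^ 2) * (-1) ^ j =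
      (∏' n : ℕ, (1 - q ^ (2 * n + 2))) * (∏' n : ℕ, (1 - q ^ (2 * n + 1))) ^ 2 := by
  have h := jacobi_triple_product hq0 hq1 (neg_ne_zero.2 one_ne_zero)
  simp only [inv_neg, inv_one, neg_one_mul, ← sub_eq_add_neg] at h
  rw [h, sq, ← mul_assoc]

lemma tsum_zpow_sq_add_eq {q : ℝ} (hq0 : 0 < q) (hq1 : q < 1) :
    ∑' j : ℤ, q ^ (j ^ 2 + j) =
      2 * (∏' n : ℕ, (1 - q ^ (2 * n + 2))) * (∏' n : ℕ, (1 + q ^ (2 * n + 2))) ^ 2 := by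
  have h := jacobi_triple_product hq0 hq1 hq0.ne'
  have e1 : ∀ n : ℕ, q * q ^ (2 * n + 1) = q ^ (2 * n + 2) := fun n => by ring
  have e2 : ∀ n : ℕ, q⁻¹ * q ^ (2 * n + 1) = q ^ (2 * n) := fun n => by field_simp; ring
  simp_rw [e1, e2, ← zpow_add₀ hq0.ne'] at h
  rw [h, tprod_pow_two_mul hq0 hq1]
  ring

lemma theta2_eq {q : ℝ} (hq0 : 0 < q) :
    theta2 q = q ^ ((1 : ℝ) / 4) * ∑' j : ℤ, q ^ (j ^ 2 + j) := by
  rw [theta2, ← tsum_mul_left]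
  refine tsum_congr fun j => ?_
  rw [← Real.rpow_intCast, ← Real.rpow_add hq0]
  congr 1
  push_cast
  ring

lemma one_sub_sq_div_theta {q : ℝ} (hq0 : 0 < q) (hq1 : q < 1) :
    (1 - (theta2 q ^ 2 / theta3 q ^ 2) ^ 2) / (2 * (theta2 q ^ 2 / theta3 q ^ 2)) =
      (∏' n : ℕ, (1 - q ^ (2 * n + 1))) ^ 12 / (8 * (q ^ ((1 : ℝ) / 4)) ^ 2) := by
  have hA := tprod_one_sub_pow_pos hq0 hq1 two_ne_zero 2 two_ne_zero
  have hE := tprod_euler hq0 hq1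
  have hJ := jacobi_theta_quartic hq0 hq1
  have hc : (q ^ ((1 : ℝ) / 4)) ^ 4 = q := by
    rw [← Real.rpow_natCast, ← Real.rpow_mul hq0.le]
    norm_num
  have hc0 : 0 < q ^ ((1 : ℝ) / 4) := by positivity
  rw [← theta3_eq_tsum_zpow, theta4_eq hq0 hq1, tsum_zpow_sq_add_eq hq0 hq1, theta3_eq hq0 hq1] at hJ
  rw [theta2_eq hq0, tsum_zpow_sq_add_eq hq0 hq1, theta3_eq hq0 hq1]
  generalize q ^ ((1 : ℝ) / 4) = c at *
  generalize ∏' n : ℕ, (1 - q ^ (2 * n + 2)) = A at *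
  generalize ∏' n : ℕ, (1 - q ^ (2 * n + 1)) = P at *
  generalize ∏' n : ℕ, (1 + q ^ (2 * n + 1)) = Q at *
  generalize ∏' n : ℕ, (1 + q ^ (2 * n + 2)) = R at *
  have hQ : Q ≠ 0 := by rintro rfl; simp at hE
  have hR : R ≠ 0 := by rintro rfl; simp at hE
  have hA' := hA.ne'
  have hk : (c * (2 * A * R ^ 2)) ^ 2 / (A * Q ^ 2) ^ 2 = 4 * c ^ 2 * R ^ 4 / Q ^ 4 := by
    field_simp
    ring
  have hJ' : Q ^ 8 - 16 * c ^ 4 * R ^ 8 = P ^ 8 := by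
    refine mul_left_cancel₀ (pow_ne_zero 4 hA') ?_
    rw [hc]
    linear_combination hJ
  have h1 : 1 - (4 * c ^ 2 * R ^ 4 / Q ^ 4) ^ 2 = P ^ 8 / Q ^ 8 := by
    rw [← hJ']
    field_simp
    ring
  have hE4 : P ^ 4 * Q ^ 4 * R ^ 4 = 1 := by
    linear_combination congrArg (· ^ 4) hE
  rw [hk, h1]
  field_simp
  linear_combination (-8 * P ^ 8) * hE4

lemma log_tprod_one_sub {q : ℝ} (hq0 : 0 < q) (hq1 : q < 1) :
    Real.log (∏' n : ℕ, (1 - q ^ (2 * n + 1))) = ∑' n : ℕ, Real.log (1 - q ^ (2 * n + 1)) := by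
  rw [← Real.rexp_tsum_eq_tprod (fun n => sub_pos.2 (pow_lt_one₀ hq0.le hq1 (by omega))), log_exp]
  simpa [sub_eq_add_neg] using Real.summable_log_one_add_of_summable
    (summable_pow_mul_add hq0 hq1 two_ne_zero 1).neg

lemma log_two_mul_gRam_pow {r : ℝ} (hr : 0 < r) :
    Real.log (2 * gRam r ^ 4) = π * √r / 6 +
      4 * ∑' n : ℕ, Real.log (1 - Real.exp (-(π * √r)) ^ (2 * n + 1)) := by
  have hs : 0 < π * √r := by positivity
  have hq0 := Real.exp_pos (-(π * √r))
  have hq1 : Real.exp (-(π * √r)) < 1 := by simpa using hs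
  have hP := tprod_one_sub_pow_pos hq0 hq1 two_ne_zero 1 one_ne_zero
  rw [← log_tprod_one_sub hq0 hq1, gRam, kSing, one_sub_sq_div_theta hq0 hq1]
  set P := ∏' n : ℕ, (1 - Real.exp (-(π * √r)) ^ (2 * n + 1))
  set c := Real.exp (-(π * √r)) ^ ((1 : ℝ) / 4) with hc
  have hc0 : 0 < c := by positivity
  have hlc : Real.log c = -(π * √r) / 4 := by
    rw [hc, Real.log_rpow hq0, Real.log_exp]; ring
  have hX : 0 < P ^ 12 / (8 * c ^ 2) := by positivity
  rw [Real.log_mul two_ne_zero (by positivity), Real.log_pow, Real.log_rpow hX,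
    Real.log_div (by positivity) (by positivity), Real.log_mul (by norm_num) (by positivity),
    Real.log_pow, Real.log_pow, hlc, show (8 : ℝ) = 2 ^ 3 by norm_num, Real.log_pow]
  push_cast
  ring

lemma hasSum_lambert_log {q : ℝ} (hq0 : 0 < q) (hq1 : q < 1) :
    HasSum (fun n : ℕ => q ^ (n + 1) / ((n + 1) * (1 - q ^ (2 * (n + 1)))))
      (-∑' n : ℕ, Real.log (1 - q ^ (2 * n + 1))) := by
  have hlog : ∀ j : ℕ, HasSum (fun n : ℕ => (q ^ (2 * j + 1)) ^ (n + 1) / ((n : ℝ) + 1))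
      (-Real.log (1 - q ^ (2 * j + 1))) := fun j =>
    Real.hasSum_pow_div_log_of_abs_lt_one (by
      rw [abs_of_pos (by positivity)]
      exact pow_lt_one₀ hq0.le hq1 (by omega))
  have hgeo : ∀ n : ℕ, HasSum (fun j : ℕ => (q ^ (2 * j + 1)) ^ (n + 1) / ((n : ℝ) + 1))
      (q ^ (n + 1) / ((n + 1) * (1 - q ^ (2 * (n + 1))))) := by
    intro n
    have h1 : q ^ (2 * (n + 1)) < 1 := pow_lt_one₀ hq0.le hq1 (by omega)
    have h := (hasSum_geometric_of_lt_one (by positivity) h1).mul_left (q ^ (n + 1) / ((n : ℝ) + 1))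
    convert! h using 1
    · funext j
      ring
    · rw [← div_div, div_eq_mul_inv]
  have hsl : Summable fun j : ℕ => Real.log (1 - q ^ (2 * j + 1)) := by
    simpa [sub_eq_add_neg] using Real.summable_log_one_add_of_summable
      (summable_pow_mul_add hq0 hq1 two_ne_zero 1).neg
  have hprod : Summable (Function.uncurry fun j n : ℕ =>
      (q ^ (2 * j + 1)) ^ (n + 1) / ((n : ℝ) + 1)) := by
    refine (summable_prod_of_nonneg fun x => by dsimp [Function.uncurry]; positivity).2
      ⟨fun j => (hlog j).summable, ?_⟩
    simp only [Function.uncurry, (hlog _).tsum_eq]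
    exact hsl.neg
  have hcomm := hprod.tsum_comm
  simp only [(hlog _).tsum_eq, (hgeo _).tsum_eq, tsum_neg] at hcomm
  rw [← hcomm]
  refine Summable.hasSum ?_
  have := hprod.prod_symm.prod
  simpa only [Function.uncurry, Prod.swap, (hgeo _).tsum_eq] using this

/-- The partial fraction expansion of the hyperbolic cotangent. -/
lemma hasSum_inv_sq_add_sq {a : ℝ} (ha : 0 < a) :
    HasSum (fun m : ℤ => 1 / ((m : ℝ) ^ 2 + a ^ 2))
      (π / a * ((1 + Real.exp (-(2 * π * a))) / (1 - Real.exp (-(2 * π * a))))) := by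
  have hx : Complex.I * a ∈ Complex.integerComplement := by
    rintro ⟨n, hn⟩
    have := congrArg Complex.im hn
    simp at this
    exact ha.ne this
  have hsum : Summable fun n : ℕ => 1 / (((n : ℝ) + 1) ^ 2 + a ^ 2) := by
    have h1 := (summable_nat_add_iff 1).2 (Real.summable_one_div_nat_pow.2 one_lt_two)
    refine Summable.of_nonneg_of_le (fun n => by positivity) (fun n => ?_) h1
    push_cast
    gcongr
    nlinarith [sq_nonneg a]
  have hcot := cot_series_rep hx
  have hexp : Complex.exp (2 * π * Complex.I * (Complex.I * a)) =
      ((Real.exp (-(2 * π * a)) : ℝ) : ℂ) := by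
    rw [Complex.ofReal_exp]
    congr 1
    push_cast
    linear_combination (2 * π * a : ℂ) * Complex.I_sq
  have hterm : ∀ n : ℕ+, 1 / (Complex.I * a - ((n : ℕ) : ℂ)) + 1 / (Complex.I * a + ((n : ℕ) : ℂ)) =
      -(2 * Complex.I * a) * ((1 / (((n : ℕ) : ℝ) ^ 2 + a ^ 2) : ℝ) : ℂ) := by
    intro n
    have h1 : Complex.I * a - ((n : ℕ) : ℂ) ≠ 0 := fun h => by
      have := congrArg Complex.im h
      simp at this
      exact ha.ne' this
    have h2 : Complex.I * a + ((n : ℕ) : ℂ) ≠ 0 := fun h => by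
      have := congrArg Complex.im h
      simp at this
      exact ha.ne' this
    have h3 : (((n : ℕ) : ℂ) ^ 2 + (a : ℂ) ^ 2) ≠ 0 := by
      have : (((n : ℕ) : ℝ) ^ 2 + a ^ 2) ≠ 0 := by positivity
      exact_mod_cast this
    push_cast
    rw [div_add_div _ _ h1 h2, mul_one_div, div_eq_div_iff (mul_ne_zero h1 h2) h3]
    linear_combination (2 * Complex.I * a * a ^ 2 : ℂ) * Complex.I_sq
  simp_rw [hterm] at hcot
  rw [tsum_mul_left, ← Complex.ofReal_tsum, tsum_pnat_eq_tsum_succ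
    (f := fun n : ℕ => 1 / ((n : ℝ) ^ 2 + a ^ 2)), Complex.cot_pi_eq_exp_ratio, hexp] at hcot
  have hE : Real.exp (-(2 * π * a)) < 1 := by
    rw [Real.exp_lt_one_iff]; linarith [mul_pos (mul_pos two_pos pi_pos) ha]
  set E := Real.exp (-(2 * π * a))
  have hE' : (1 - E : ℂ) ≠ 0 := by
    exact_mod_cast (sub_pos.2 hE).ne'
  have haC : (a : ℂ) ≠ 0 := by exact_mod_cast ha.ne'
  have hval : ∑' n : ℕ, 1 / (((n + 1 : ℕ) : ℝ) ^ 2 + a ^ 2) =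
      (π / a * ((1 + E) / (1 - E)) - 1 / a ^ 2) / 2 := by
    have : ((∑' n : ℕ, 1 / (((n + 1 : ℕ) : ℝ) ^ 2 + a ^ 2) : ℝ) : ℂ) =
        (((π / a * ((1 + E) / (1 - E)) - 1 / a ^ 2) / 2 : ℝ) : ℂ) := by
      push_cast at hcot ⊢
      generalize ∑' n : ℕ, 1 / (((n : ℂ) + 1) ^ 2 + (a : ℂ) ^ 2) = S at *
      have hI := Complex.I_ne_zero
      field_simp at hcot ⊢
      rw [Complex.I_sq] at hcot
      linear_combination -hcot
    exact_mod_cast this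
  have hn : HasSum (fun n : ℕ => 1 / (((n : ℝ) + 1) ^ 2 + a ^ 2))
      ((π / a * ((1 + E) / (1 - E)) - 1 / a ^ 2) / 2) := by
    rw [← hval]
    push_cast
    exact hsum.hasSum
  have h := HasSum.of_add_one_of_neg_add_one (f := fun m : ℤ => 1 / ((m : ℝ) ^ 2 + a ^ 2))
    (by simpa using hn) (by
      have e : ∀ n : ℕ, (1 : ℝ) / (((-((n : ℤ) + 1) : ℤ) : ℝ) ^ 2 + a ^ 2) =
          1 / (((n : ℝ) + 1) ^ 2 + a ^ 2) := fun n => by push_cast; rw [neg_sq]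
      simp_rw [e]
      exact hn)
  convert! h using 1
  simp
  ring

lemma hasSum_alternating_inv_sq_add_sq {a : ℝ} (ha : 0 < a) :
    HasSum (fun m : ℤ => (-1 : ℝ) ^ m / ((m : ℝ) ^ 2 + a ^ 2))
      (2 * π / a * (Real.exp (-(π * a)) / (1 - Real.exp (-(π * a)) ^ 2))) := by
  have h1 := hasSum_inv_sq_add_sq ha
  have h2 := (hasSum_inv_sq_add_sq (half_pos ha)).mul_left (1 / 4)
  have heven : HasSum (fun m : ℤ => if Even m then 1 / ((m : ℝ) ^ 2 + a ^ 2) else 0)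
      (1 / 4 * (π / (a / 2) * ((1 + Real.exp (-(2 * π * (a / 2)))) /
        (1 - Real.exp (-(2 * π * (a / 2))))))) := by
    refine (Function.Injective.hasSum_iff (g := fun m : ℤ => 2 * m)
      (fun x y h => by simpa using h) ?_).1 ?_
    · intro m hm
      rw [if_neg]
      rintro ⟨k, rfl⟩
      exact hm ⟨k, by ring⟩
    · convert! h2 using 1
      funext m
      simp only [Function.comp, even_two_mul, if_true]
      push_cast
      field_simp
      ring
  have h := (heven.mul_left 2).sub h1
  have hE1 : Real.exp (-(2 * π * a)) = Real.exp (-(π * a)) ^ 2 := by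
    rw [← Real.exp_nat_mul]; congr 1; push_cast; ring
  have hE2 : Real.exp (-(2 * π * (a / 2))) = Real.exp (-(π * a)) := by congr 1; ring
  rw [hE1, hE2] at h
  have hE0 := Real.exp_pos (-(π * a))
  have hE : Real.exp (-(π * a)) < 1 := by
    rw [Real.exp_lt_one_iff]; linarith [mul_pos pi_pos ha]
  set E := Real.exp (-(π * a))
  convert! h using 1
  · funext m
    split_ifs with hm
    · rw [hm.neg_one_zpow]; ring
    · rw [(Int.not_even_iff_odd.1 hm).neg_one_zpow]; ring
  · have h3 : 1 - E ≠ 0 := (sub_pos.2 hE).ne'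
    have h4 : 1 - E ^ 2 ≠ 0 := by nlinarith
    field_simp
    ring

lemma hasSum_int_ne_zero {f : ℤ → ℝ} {s : ℝ} (h0 : f 0 = 0) (heven : ∀ n, f (-n) = f n)
    (h : HasSum (fun n : ℕ => f (n + 1)) s) :
    HasSum (fun n : {n : ℤ // n ≠ 0} => f n) (2 * s) := by
  have hz := HasSum.of_add_one_of_neg_add_one h (by simpa only [heven] using h)
  rw [h0, add_zero, ← two_mul] at hz
  exact (hasSum_subtype_iff_of_support_subset (s := {n : ℤ | n ≠ 0}) fun n hn hn0 =>
    hn (by rw [hn0, h0])).2 hz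

lemma hasSum_alternating_inv_sq :
    HasSum (fun m : {m : ℤ // m ≠ 0} => (-1 : ℝ) ^ (m : ℤ) / ((m : ℤ) : ℝ) ^ 2) (-(π ^ 2 / 6)) := by
  have h := hasSum_one_div_nat_pow_mul_cos one_ne_zero (x := 1 / 2) (by norm_num)
  have hs : HasSum (fun n : ℕ => (-1 : ℝ) ^ n / (n : ℝ) ^ 2) (-(π ^ 2 / 12)) := by
    convert! h using 1
    · funext n
      rw [show 2 * π * n * (1 / 2) = n * π by ring, Real.cos_nat_mul_pi]
      ring
    · have hB := bernoulliFun_two (1 / 2)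
      rw [bernoulliFun] at hB
      rw [mul_one, hB]
      norm_num
      ring
  have hs' := (hasSum_nat_add_iff' 1).2 hs
  convert! hasSum_int_ne_zero (f := fun m : ℤ => (-1 : ℝ) ^ m / (m : ℝ) ^ 2) (s := -(π ^ 2 / 12))
    (by simp) (fun n => by simp [zpow_neg, ← inv_zpow]) ?_ using 1
  · ring
  · convert! hs' using 1
    simp

/-- The lattice sum over `ℤ² \ {(0,0)}` of `(−1)^m/(m² + r·n²)` equals
`−(π/√r)·log(2·g_r⁴)`: splitting the lattice sum as
`∑_{n≠0} (∑_{m∈ℤ} (−1)^m/(m² + r·n²)) + ∑_{m≠0} (−1)^m/m²`,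
each displayed sum is absolutely convergent and the total equals
`−(π/√r)·log(2·g_r⁴)`. -/
theorem lattice_sum_eq_log (r : ℝ) (hr : 0 < r) :
    (∀ n : ℤ, n ≠ 0 →
      Summable fun m : ℤ => (-1 : ℝ) ^ m / ((m : ℝ) ^ 2 + r * (n : ℝ) ^ 2)) ∧
    Summable (fun n : {n : ℤ // n ≠ 0} =>
      ∑' m : ℤ, (-1 : ℝ) ^ m / ((m : ℝ) ^ 2 + r * ((n : ℤ) : ℝ) ^ 2)) ∧
    Summable (fun m : {m : ℤ // m ≠ 0} => (-1 : ℝ) ^ (m : ℤ) / ((m : ℤ) : ℝ) ^ 2) ∧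
    (∑' n : {n : ℤ // n ≠ 0},
        ∑' m : ℤ, (-1 : ℝ) ^ m / ((m : ℝ) ^ 2 + r * ((n : ℤ) : ℝ) ^ 2)) +
      (∑' m : {m : ℤ // m ≠ 0}, (-1 : ℝ) ^ (m : ℤ) / ((m : ℤ) : ℝ) ^ 2) =
      -(π / Real.sqrt r) * Real.log (2 * gRam r ^ 4) := by
  have hsr : 0 < √r := Real.sqrt_pos.2 hr
  have hs : 0 < π * √r := by positivity
  have hq0 := Real.exp_pos (-(π * √r))
  have hq1 : Real.exp (-(π * √r)) < 1 := by simpa using hs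
  have hlog := log_two_mul_gRam_pow hr
  have hlam := hasSum_lambert_log hq0 hq1
  have hexp : ∀ k : ℕ, Real.exp (-(π * (√r * k))) = Real.exp (-(π * √r)) ^ k := fun k => by
    rw [← Real.exp_nat_mul]; congr 1; ring
  set q := Real.exp (-(π * √r))
  set L := ∑' n : ℕ, Real.log (1 - q ^ (2 * n + 1))
  have hinner : ∀ n : ℤ, n ≠ 0 →
      HasSum (fun m : ℤ => (-1 : ℝ) ^ m / ((m : ℝ) ^ 2 + r * (n : ℝ) ^ 2))
        (2 * π / √r * (q ^ n.natAbs / (n.natAbs * (1 - q ^ (2 * n.natAbs))))) := by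
    intro n hn
    have hk : (0 : ℝ) < n.natAbs := by exact_mod_cast Int.natAbs_pos.2 hn
    have h := hasSum_alternating_inv_sq_add_sq (mul_pos hsr hk)
    rw [hexp, ← pow_mul, mul_comm n.natAbs 2] at h
    have hsq : (√r * (n.natAbs : ℝ)) ^ 2 = r * (n : ℝ) ^ 2 := by
      rw [mul_pow, Real.sq_sqrt hr.le, Nat.cast_natAbs, Int.cast_abs, sq_abs]
    rw [hsq] at h
    convert! h using 1
    rw [← div_div, ← div_div]
    ring
  have houter : HasSum (fun n : {n : ℤ // n ≠ 0} =>
      ∑' m : ℤ, (-1 : ℝ) ^ m / ((m : ℝ) ^ 2 + r * ((n : ℤ) : ℝ) ^ 2))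
      (2 * (2 * π / √r * -L)) := by
    have h := hasSum_int_ne_zero (f := fun n : ℤ =>
      2 * π / √r * (q ^ n.natAbs / (n.natAbs * (1 - q ^ (2 * n.natAbs))))) (s := 2 * π / √r * -L)
      (by simp) (fun n => by simp) (by
        convert! hlam.mul_left (2 * π / √r) using 1
        funext n
        have : ((n : ℤ) + 1).natAbs = n + 1 := by omega
        rw [this]
        push_cast
        rfl)
    convert! h using 1
    funext n
    exact (hinner n n.2).tsum_eq
  refine ⟨fun n hn => (hinner n hn).summable, houter.summable, hasSum_alternating_inv_sq.summable, ?_⟩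
  rw [houter.tsum_eq, hasSum_alternating_inv_sq.tsum_eq, hlog]
  field_simp
  ring
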